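/- If for every leaf ℓ of a finite set L and every time t before stopping, the number of pulls satisfies N_ℓ(τ−1) ≤ a_ℓ·β(N_ℓ(τ−1)) where β(s) = C + (3/2)·ln(1+ln s) with C ≥ 1 and a_ℓ ≥ 8, then the total stopping time τ = 1 + Σ_{ℓ∈L} N_ℓ(τ−1) satisfies τ ≤ 1 + Σ_{ℓ∈L} a_ℓ·(C + 2·ln(1 + ln(a_ℓ·C))). -/

import Mathlib

theorem log_tangent {x y : ℝ} (hx : 0 < x) (hy : 0 < y) :
    Real.log x ≤ Real.log y + (x - y) / y := by
  have h := Real.log_le_sub_one_of_pos (div_pos hx hy)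
  rw [Real.log_div hx.ne' hy.ne'] at h
  have : (x - y) / y = x / y - 1 := by field_simp
  linarith

theorem leaf_bound {x a C : ℝ} (hC : 1 ≤ C) (ha : 8 ≤ a)
    (hx : x ≤ a * (C + 3 / 2 * Real.log (1 + Real.log x))) :
    x ≤ a * (C + 2 * Real.log (1 + Real.log (a * C))) := by
  by_contra! hlt
  have he : Real.exp 1 < 2.7182818286 := Real.exp_one_lt_d9
  have hl8 : 2 ≤ Real.log 8 := by
    rw [Real.le_log_iff_exp_le (by norm_num)]
    have : Real.exp 2 = Real.exp 1 * Real.exp 1 := by rw [← Real.exp_add]; norm_num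
    nlinarith [Real.exp_pos 1]
  have hA : 8 ≤ a * C := by nlinarith
  have hu : 3 ≤ 1 + Real.log (a * C) := by
    linarith [Real.log_le_log (by norm_num) hA]
  set u := 1 + Real.log (a * C) with hud
  set t := Real.log u with htd
  have ht : 1 ≤ t := by
    rw [htd, Real.le_log_iff_exp_le (by linarith)]
    linarith
  have hu0 : 0 < u := by linarith
  set S := a * (C + 2 * t) with hS
  have hSa : 8 ≤ S := by nlinarith
  have hSa' : a ≤ S := by nlinarith
  have hlS : 2 ≤ Real.log S := by
    linarith [Real.log_le_log (by norm_num) hSa]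
  have h3 : Real.log 3 ≤ 7 / 6 := by
    rw [Real.log_le_iff_le_exp (by norm_num)]
    have h1 : (2.7182818283 : ℝ) < Real.exp 1 := Real.exp_one_gt_d9
    have h2 : Real.exp (7 / 6) = Real.exp 1 * Real.exp (1 / 6) := by
      rw [← Real.exp_add]; norm_num
    have := Real.add_one_le_exp (1 / 6 : ℝ)
    nlinarith
  have h12 : Real.log (1 + 2 * t) ≤ t + t ^ 2 / 6 := by
    have := log_tangent (x := 1 + 2 * t) (y := 3) (by linarith) (by norm_num)
    nlinarith
  have hSle : 1 + Real.log S ≤ u + Real.log (1 + 2 * t) := by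
    have : S ≤ (a * C) * (1 + 2 * t) := by
      have : 0 ≤ a * t * (C - 1) := by
        apply mul_nonneg <;> nlinarith
      rw [hS]; nlinarith
    have h := Real.log_le_log (by linarith) this
    rw [Real.log_mul (x := a * C) (y := 1 + 2 * t) (by linarith) (by linarith)] at h
    linarith
  have hq : 1 + t / 3 + (t / 3) ^ 2 / 2 ≤ Real.exp (t / 3) :=
    Real.quadratic_le_exp_of_nonneg (by linarith)
  have hkey : 1 + Real.log S ≤ u * Real.exp (t / 3) := by
    have : 0 ≤ (u - 3) * (t / 3 + (t / 3) ^ 2 / 2) := by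
      apply mul_nonneg
      · linarith
      · positivity
    have := mul_le_mul_of_nonneg_left hq hu0.le
    nlinarith
  have hll : Real.log (1 + Real.log S) ≤ 4 / 3 * t := by
    have h := Real.log_le_log (by linarith) hkey
    rw [Real.log_mul hu0.ne' (Real.exp_pos _).ne', Real.log_exp] at h
    linarith
  have hx0 : 0 < x := by linarith
  have hlx : Real.log S ≤ Real.log x := Real.log_le_log (by linarith) hlt.le
  have e1 := log_tangent (x := 1 + Real.log x) (y := 1 + Real.log S) (by linarith) (by linarith)
  have e2 := log_tangent hx0 (show 0 < S by linarith)
  have e3 : (1 + Real.log x - (1 + Real.log S)) / (1 + Real.log S) ≤ (x - S) / S / 3 := by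
    apply div_le_div₀ <;> linarith
  have e4 : a * ((x - S) / S) ≤ x - S := by
    rw [mul_div_assoc', div_le_iff₀ (by linarith)]
    nlinarith
  have e5 : a * Real.log (1 + Real.log x) ≤ a * (4 / 3 * t + (x - S) / S / 3) :=
    mul_le_mul_of_nonneg_left (by linarith) (by linarith)
  nlinarith


/-- Combining the per-leaf bound `N_ℓ(τ−1) ≤ a_ℓ·β(N_ℓ(τ−1))`, where
`β(s) = C + (3/2)·ln(1 + ln s)`, with the log-log inversion lemma: the stopping
time `τ = 1 + ∑_ℓ N_ℓ(τ−1)` satisfies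
`τ ≤ 1 + ∑_ℓ a_ℓ·(C + 2·ln(1 + ln(a_ℓ·C)))`. -/
theorem stmt19 {L : Type*} [Fintype L] (N : L → ℕ) (a : L → ℝ) (C : ℝ)
    (hC : 1 ≤ C) (ha : ∀ ℓ, 8 ≤ a ℓ)
    (hcorr : ∀ ℓ, 3 ≤ C * (1 + Real.log (a ℓ * C)))
    (hN : ∀ ℓ, (N ℓ : ℝ) ≤ a ℓ * (C + 3 / 2 * Real.log (1 + Real.log (N ℓ)))) :
    1 + ∑ ℓ, (N ℓ : ℝ) ≤
      1 + ∑ ℓ, a ℓ * (C + 2 * Real.log (1 + Real.log (a ℓ * C))) := by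
  have h : ∑ ℓ, (N ℓ : ℝ) ≤ ∑ ℓ, a ℓ * (C + 2 * Real.log (1 + Real.log (a ℓ * C))) :=
    Finset.sum_le_sum fun ℓ _ => leaf_bound hC (ha ℓ) (hN ℓ)
  linarith
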